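/- Let I be a compact Hausdorff space and let f_i : ℝ^m → ℝ, i ∈ I, be convex functions such that (i,x) ↦ f_i(x) is continuous on I × ℝ^m; set f(x) := max_{i∈I} f_i(x), I_f(x) := {i ∈ I : f_i(x) = f(x)}, and S_f := {x : f(x) ≤ 0}. Suppose there exists τ ∈ (0,+∞) such that inf{|min_{‖h‖=1} f'(x̄,h)| : x̄ ∈ bdry(S_f)} > τ and the qualification condition (QC) holds: for any sequence {z_k} ⊆ S_f \ bdry(S_f), if there exists a sequence {x_k} ⊆ bdry(S_f) with lim_{k→∞} (f(z_k) − f(x_k))/‖z_k − x_k‖ = 0, then liminf_{k→∞} |min_{‖h‖=1} f'(z_k,h)| > τ. Then there exist constants c, ε > 0 such that whenever G ∈ C(I × ℝ^m, ℝ), with g_i(x) := G(i,x), each g_i is convex, g(x) := max_{i∈I} g_i(x), I_g(x) := {i ∈ I : g_i(x) = g(x)}, and: {z ∈ bdry(S_f) : f_i(z) = g_i(z) for all i ∈ I} ≠ ∅; sup_{i∈I} Lip(f_i − g_i) < ε; I_g(x) ⊆ I_f(x) whenever min_{‖h‖=1} f'(x,h) < 0; and I_f(x) ⊆ I_g(x)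 whenever min_{‖h‖=1} f'(x,h) > 0, one has τ_min(G) ≤ c. -/

import Mathlib

open Filter Metric Set Topology
open scoped ENNReal

noncomputable section

/-- The Euclidean space `ℝ^m`. -/
abbrev Euc (m : ℕ) := EuclideanSpace ℝ (Fin m)

/-- Directional derivative `g'(x,h) = inf_{t>0} (g(x+th) - g(x))/t` of a real-valued
convex function. -/
def rDirDeriv {m : ℕ} (g : Euc m → ℝ) (x h : Euc m) : ℝ :=
  ⨅ t : {t : ℝ // 0 < t}, (g (x + (t : ℝ) • h) - g x) / (t : ℝ)

/-- `min_{‖h‖=1} g'(x,h)`. -/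
def rMinDirDeriv {m : ℕ} (g : Euc m → ℝ) (x : Euc m) : ℝ :=
  ⨅ h : sphere (0 : Euc m) 1, rDirDeriv g x (h : Euc m)

/-- `f(x) = max_{i ∈ I} f_i(x)`. -/
def fmax {m : ℕ} {I : Type*} [Nonempty I] (F : I → Euc m → ℝ) (x : Euc m) : ℝ := ⨆ i, F i x

/-- The active index set `I_f(x) = {i ∈ I : f_i(x) = f(x)}`. -/
def activeSet {m : ℕ} {I : Type*} [Nonempty I] (F : I → Euc m → ℝ) (x : Euc m) : Set I :=
  {i | F i x = fmax F x}

/-- The solution set `S_G = {x : g_i(x) ≤ 0 for all i ∈ I}` of the system. -/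
def SG {m : ℕ} {I : Type*} (G : I → Euc m → ℝ) : Set (Euc m) := {x | ∀ i, G i x ≤ 0}

/-- The local error bound modulus `τ_min(G, x₀)` of the system (in `ℝ≥0∞`). -/
def tauMinLocSys {m : ℕ} {I : Type*} [Nonempty I] (G : I → Euc m → ℝ) (x₀ : Euc m) : ℝ≥0∞ :=
  ⨅ τ ∈ {τ : ℝ | 0 < τ ∧ ∃ δ > (0:ℝ), ∀ x ∈ ball x₀ δ,
      EMetric.infEdist x (SG G) ≤ ENNReal.ofReal (τ * max (fmax G x) 0)},
    ENNReal.ofReal τ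

/-- The global error bound modulus `τ_min(G)` of the system (in `ℝ≥0∞`). -/
def tauMinSys {m : ℕ} {I : Type*} [Nonempty I] (G : I → Euc m → ℝ) : ℝ≥0∞ :=
  ⨅ τ ∈ {τ : ℝ | 0 < τ ∧ ∀ x,
      EMetric.infEdist x (SG G) ≤ ENNReal.ofReal (τ * max (fmax G x) 0)},
    ENNReal.ofReal τ

/-- `Lip(φ) = sup_{u ≠ v} |φ(u) - φ(v)|/‖u - v‖` (in `ℝ≥0∞`). -/
def lipR {m : ℕ} (φ : Euc m → ℝ) : ℝ≥0∞ :=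
  ⨆ u, ⨆ v, ⨆ _ : u ≠ v, ENNReal.ofReal |φ u - φ v| / edist u v

/-- The qualification condition (QC) for `f`: for every sequence `{z_k} ⊆ S_f \ bdry(S_f)`,
if there is a sequence `{x_k} ⊆ bdry(S_f)` with `(f(z_k) - f(x_k))/‖z_k - x_k‖ → 0`, then
`liminf_k |min_{‖h‖=1} f'(z_k,h)| > τ`. -/
def QCr {m : ℕ} (f : Euc m → ℝ) (τ : ℝ) : Prop :=
  ∀ z x : ℕ → Euc m,
    (∀ k, z k ∈ {y : Euc m | f y ≤ 0} \ frontier {y : Euc m | f y ≤ 0}) →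
    (∀ k, x k ∈ frontier {y : Euc m | f y ≤ 0}) →
    Tendsto (fun k => (f (z k) - f (x k)) / ‖z k - x k‖) atTop (𝓝 0) →
    ENNReal.ofReal τ < liminf (fun k => ENNReal.ofReal |rMinDirDeriv f (z k)|) atTop

section

variable {m : ℕ} {I : Type*}

theorem exists_descent_of_rMinDirDeriv_lt {f : Euc m → ℝ} {x : Euc m} {δ : ℝ} (hδ : 0 ≤ δ)
    (hx : rMinDirDeriv f x < -δ) :
    ∃ h : Euc m, ‖h‖ = 1 ∧ ∃ t > (0 : ℝ), f (x + t • h) < f x - δ * t := by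
  unfold rMinDirDeriv at hx
  rcases isEmpty_or_nonempty (sphere (0 : Euc m) 1) with hE | hE
  · rw [Real.iInf_of_isEmpty] at hx
    linarith
  obtain ⟨⟨h, hh⟩, hlt⟩ := exists_lt_of_ciInf_lt hx
  have : Nonempty {t : ℝ // 0 < t} := ⟨⟨1, one_pos⟩⟩
  obtain ⟨⟨t, ht⟩, hlt⟩ := exists_lt_of_ciInf_lt hlt
  refine ⟨h, by simpa using hh, t, ht, ?_⟩
  have := (div_lt_iff₀ ht).1 hlt
  simp only at this
  linarith

theorem lt_of_lt_real_iInf {ι : Sort*} {u : ι → ℝ} {a : ℝ} (ha : 0 ≤ a) (h : a < ⨅ i, u i)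
    (i : ι) : a < u i := by
  by_cases hb : BddBelow (range u)
  · exact h.trans_le (ciInf_le hb i)
  · rw [Real.iInf_of_not_bddBelow hb] at h
    linarith

theorem sharp_growth_of_lt_rMinDirDeriv {f : Euc m → ℝ} {y : Euc m} {τ : ℝ} (hτ : 0 ≤ τ)
    (hy : τ < rMinDirDeriv f y) (x : Euc m) : f y + τ * ‖x - y‖ ≤ f x := by
  rcases eq_or_ne x y with rfl | hne
  · simp
  have hn : 0 < ‖x - y‖ := norm_pos_iff.2 (sub_ne_zero.2 hne)
  have hmem : ‖x - y‖⁻¹ • (x - y) ∈ sphere (0 : Euc m) 1 := by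
    simp [norm_smul, hn.ne']
  have h := lt_of_lt_real_iInf hτ (lt_of_lt_real_iInf hτ hy ⟨_, hmem⟩) ⟨‖x - y‖, hn⟩
  simp only [smul_inv_smul₀ hn.ne', add_sub_cancel] at h
  have := (lt_div_iff₀ hn).1 h
  linarith

theorem rMinDirDeriv_neg_of_descent {f : Euc m → ℝ} (hf : ConvexOn ℝ univ f) {x h : Euc m}
    (hh : ‖h‖ = 1) {t : ℝ} (ht : 0 < t) (hlt : f (x + t • h) < f x) : rMinDirDeriv f x < 0 := by
  have hfc : Continuous f := hf.locallyLipschitz.continuous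
  obtain ⟨K, hK⟩ := (isCompact_sphere (0 : Euc m) 1).bddAbove_image
    (f := fun h => f (x - h)) (by fun_prop)
  have hquot : ∀ h : Euc m, ‖h‖ = 1 → ∀ t : {t : ℝ // 0 < t},
      f x - K ≤ (f (x + (t : ℝ) • h) - f x) / t := by
    rintro h hh ⟨t, ht⟩
    have hKh : f (x - h) ≤ K := hK ⟨h, by simpa using hh, rfl⟩
    have hc := hf.2 (mem_univ (x + t • h)) (mem_univ (x - h))
      (show 0 ≤ 1 / (1 + t) by positivity) (show 0 ≤ t / (1 + t) by positivity) (by field_simp)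
    have hcomb : (1 / (1 + t)) • (x + t • h) + (t / (1 + t)) • (x - h) = x := by
      have h1 : (1 / (1 + t)) + (t / (1 + t)) = 1 := by field_simp
      have h2 : (1 / (1 + t)) * t = t / (1 + t) := by ring
      rw [smul_add, smul_sub, smul_smul, h2]
      calc _ = (1 / (1 + t) + t / (1 + t)) • x := by module
        _ = x := by rw [h1, one_smul]
    rw [hcomb] at hc
    simp only [smul_eq_mul] at hc
    have hc' : (1 + t) * f x ≤ f (x + t • h) + t * f (x - h) := by
      have := mul_le_mul_of_nonneg_left hc (by positivity : 0 ≤ 1 + t)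
      field_simp at this
      linarith
    rw [le_div_iff₀ ht]
    nlinarith
  have hbdd : ∀ h : Euc m, ‖h‖ = 1 → BddBelow (range fun t : {t : ℝ // 0 < t} =>
      (f (x + (t : ℝ) • h) - f x) / (t : ℝ)) := fun h hh =>
    ⟨f x - K, by rintro _ ⟨t, rfl⟩; exact hquot h hh t⟩
  have : Nonempty {t : ℝ // 0 < t} := ⟨⟨1, one_pos⟩⟩
  calc rMinDirDeriv f x ≤ rDirDeriv f x h :=
        ciInf_le (f := fun h : sphere (0 : Euc m) 1 => rDirDeriv f x (h : Euc m))
          ⟨f x - K, by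
            rintro _ ⟨⟨h, hh⟩, rfl⟩
            exact le_ciInf (hquot h (by simpa using hh))⟩ ⟨h, by simpa using hh⟩
    _ ≤ (f (x + t • h) - f x) / t := ciInf_le (hbdd h hh) ⟨t, ht⟩
    _ < 0 := div_neg_of_neg_of_pos (by linarith) ht

/-- A descent direction of rate `δ` at every boundary zero gives an error bound. -/
theorem exists_frontier_le_of_descent {f : Euc m → ℝ} (hf : ConvexOn ℝ univ f)
    (hne : ∃ z, f z ≤ 0) {δ : ℝ} (hδ : 0 < δ)
    (hdesc : ∀ y ∈ frontier {y | f y ≤ 0},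
      ∃ h : Euc m, ‖h‖ = 1 ∧ ∃ t > (0 : ℝ), f (y + t • h) ≤ f y - δ * t)
    {x : Euc m} (hx : 0 < f x) :
    ∃ y, f y = 0 ∧ 0 < ‖x - y‖ ∧ δ * ‖x - y‖ ≤ f x := by
  have hfc : Continuous f := hf.locallyLipschitz.continuous
  obtain ⟨z, hz⟩ := hne
  obtain ⟨y, hyfr, hyd⟩ := exists_mem_frontier_infDist_compl_eq_dist (x := x)
    (s := {y | f y ≤ 0}ᶜ) (by simpa using hx)
    (by rw [Ne, compl_univ_iff]; exact Set.Nonempty.ne_empty ⟨z, hz⟩)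
  rw [frontier_compl] at hyfr
  rw [compl_compl, dist_eq_norm] at hyd
  have hy0 : f y = 0 := frontier_le_subset_eq hfc continuous_const hyfr
  have hD : 0 < ‖x - y‖ := by
    rw [norm_pos_iff, sub_ne_zero]
    rintro rfl
    exact hx.ne' hy0
  refine ⟨y, hy0, hD, ?_⟩
  obtain ⟨h, hh, t, ht, hlt⟩ := hdesc y hyfr
  rw [hy0] at hlt
  have hs : 0 < f x + δ * t := by positivity
  have hc := hf.2 (mem_univ x) (mem_univ (y + t • h))
    (show 0 ≤ δ * t / (f x + δ * t) by positivity) (show 0 ≤ f x / (f x + δ * t) by positivity)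
    (by field_simp; ring)
  set w := (δ * t / (f x + δ * t)) • x + (f x / (f x + δ * t)) • (y + t • h) with hw
  have hw0 : f w ≤ 0 := by
    refine hc.trans ?_
    simp only [smul_eq_mul]
    calc _ ≤ δ * t / (f x + δ * t) * f x + f x / (f x + δ * t) * (0 - δ * t) := by gcongr
      _ = 0 := by ring
  have hdist := infDist_le_dist_of_mem (x := x) (s := {y | f y ≤ 0}) hw0
  rw [hyd, dist_eq_norm] at hdist
  have hxw : x - w = (f x / (f x + δ * t)) • ((x - y) - t • h) := by
    have h1 : δ * t / (f x + δ * t) = 1 - f x / (f x + δ * t) := by field_simp; ring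
    rw [hw, h1]
    module
  have hle : ‖x - w‖ ≤ f x / (f x + δ * t) * (‖x - y‖ + t) := by
    rw [hxw, norm_smul, Real.norm_of_nonneg (by positivity)]
    gcongr
    refine (norm_sub_le _ _).trans ?_
    rw [norm_smul, hh, Real.norm_of_nonneg ht.le, mul_one]
  have hfin := hdist.trans hle
  rw [div_mul_eq_mul_div, le_div_iff₀ hs] at hfin
  nlinarith

/-- Descent along a ray for each member of a compact family of convex functions is uniform. -/
theorem exists_uniform_descent [TopologicalSpace I] [CompactSpace I] {G : I → Euc m → ℝ}
    (hcont : Continuous fun p : I × Euc m => G p.1 p.2) (hconv : ∀ i, ConvexOn ℝ univ (G i))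
    {y h : Euc m} {δ : ℝ} (hy : ∀ i, G i y ≤ 0)
    (hdesc : ∀ i, ∃ t > (0 : ℝ), G i (y + t • h) < -(δ * t)) :
    ∃ t > (0 : ℝ), ∀ i, G i (y + t • h) ≤ -(δ * t) := by
  suffices H : ∃ T > (0 : ℝ), ∀ i ∈ (univ : Set I), ∀ t, 0 < t → t ≤ T →
      G i (y + t • h) ≤ -(δ * t) by
    obtain ⟨T, hT, H⟩ := H
    exact ⟨T, hT, fun i => H i (mem_univ i) T hT le_rfl⟩
  refine isCompact_univ.induction_on (p := fun s : Set I => ∃ T > (0 : ℝ), ∀ i ∈ s, ∀ t, 0 < t →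
    t ≤ T → G i (y + t • h) ≤ -(δ * t)) ⟨1, one_pos, by simp⟩ ?_ ?_ ?_
  · rintro s s' hss ⟨T, hT, H⟩
    exact ⟨T, hT, fun i hi => H i (hss hi)⟩
  · rintro s s' ⟨T, hT, H⟩ ⟨T', hT', H'⟩
    refine ⟨min T T', lt_min hT hT', fun i hi t ht htT => ?_⟩
    rcases hi with hi | hi
    · exact H i hi t ht (htT.trans (min_le_left _ _))
    · exact H' i hi t ht (htT.trans (min_le_right _ _))
  · intro i _
    obtain ⟨T, hT, hlt⟩ := hdesc i
    have hopen : IsOpen {j | G j (y + T • h) < -(δ * T)} :=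
      isOpen_lt (hcont.comp (by fun_prop : Continuous fun j => (j, y + T • h))) continuous_const
    refine ⟨_, mem_nhdsWithin_of_mem_nhds (hopen.mem_nhds hlt), T, hT, fun j hj t ht htT => ?_⟩
    have hc := (hconv j).2 (mem_univ y) (mem_univ (y + T • h))
      (show 0 ≤ 1 - t / T by rw [sub_nonneg, div_le_one hT]; exact htT)
      (show 0 ≤ t / T by positivity) (by ring)
    have hcomb : (1 - t / T) • y + (t / T) • (y + T • h) = y + t • h := by
      have : t • h = (t / T) • T • h := by rw [smul_smul, div_mul_cancel₀ _ hT.ne']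
      rw [this]
      module
    rw [hcomb] at hc
    simp only [smul_eq_mul] at hc
    have h1 : (1 - t / T) * G j y ≤ 0 :=
      mul_nonpos_of_nonneg_of_nonpos (by rw [sub_nonneg, div_le_one hT]; exact htT) (hy j)
    have h2 : t / T * G j (y + T • h) ≤ t / T * -(δ * T) := by
      have : G j (y + T • h) < -(δ * T) := hj
      gcongr
    have h3 : t / T * -(δ * T) = -(δ * t) := by field_simp
    linarith

section fmax

variable [TopologicalSpace I] [CompactSpace I] [Nonempty I] {F : I → Euc m → ℝ}

theorem le_fmax (hcont : Continuous fun p : I × Euc m => F p.1 p.2) (x : Euc m) (i : I) :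
    F i x ≤ fmax F x := by
  have hc : Continuous fun i => F i x := hcont.comp (by fun_prop : Continuous fun j => (j, x))
  exact le_ciSup (f := fun i => F i x) (isCompact_range hc).bddAbove i

theorem convexOn_fmax (hcont : Continuous fun p : I × Euc m => F p.1 p.2)
    (hconv : ∀ i, ConvexOn ℝ univ (F i)) : ConvexOn ℝ univ (fmax F) := by
  refine ⟨convex_univ, fun x _ y _ a b ha hb hab => ciSup_le fun i => ?_⟩
  refine ((hconv i).2 (mem_univ x) (mem_univ y) ha hb hab).trans ?_
  simp only [smul_eq_mul]
  gcongr
  exacts [le_fmax hcont x i, le_fmax hcont y i]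

theorem mem_SG_iff (hcont : Continuous fun p : I × Euc m => F p.1 p.2) {x : Euc m} :
    x ∈ SG F ↔ fmax F x ≤ 0 :=
  ⟨fun h => ciSup_le h, fun h i => (le_fmax hcont x i).trans h⟩

/-- An error bound at all infeasible points bounds the global modulus. -/
theorem tauMinSys_le (hcont : Continuous fun p : I × Euc m => F p.1 p.2) {c : ℝ} (hc : 0 < c)
    (H : ∀ x, 0 < fmax F x → ∃ y, fmax F y ≤ 0 ∧ ‖x - y‖ ≤ c * fmax F x) :
    tauMinSys F ≤ ENNReal.ofReal c := by
  refine iInf₂_le c ⟨hc, fun x => ?_⟩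
  rcases le_or_gt (fmax F x) 0 with hx | hx
  · exact (infEDist_le_edist_of_mem ((mem_SG_iff hcont).2 hx)).trans (by simp)
  · obtain ⟨y, hy, hxy⟩ := H x hx
    refine (infEDist_le_edist_of_mem ((mem_SG_iff hcont).2 hy)).trans ?_
    rw [edist_dist, dist_eq_norm, max_eq_left hx.le]
    exact ENNReal.ofReal_le_ofReal hxy

end fmax

theorem abs_sub_le_of_lipR_lt {φ : Euc m → ℝ} {ε : ℝ} (hε : 0 ≤ ε)
    (h : lipR φ ≤ ENNReal.ofReal ε) (u v : Euc m) : |φ u - φ v| ≤ ε * ‖u - v‖ := by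
  rcases eq_or_ne u v with rfl | hne
  · simp
  have h1 : ENNReal.ofReal |φ u - φ v| / edist u v ≤ ENNReal.ofReal ε := by
    refine le_trans ?_ h
    exact le_iSup_of_le u (le_iSup_of_le v (le_iSup_of_le hne le_rfl))
  rw [ENNReal.div_le_iff (by simpa using hne) (edist_ne_top _ _), edist_dist,
    ← ENNReal.ofReal_mul hε, ENNReal.ofReal_le_ofReal_iff (by positivity), dist_eq_norm] at h1
  exact h1

theorem QCr.exists_uniform {f : Euc m → ℝ} {τ : ℝ} (hqc : QCr f τ) :
    ∃ ε > (0 : ℝ), ∀ z x : Euc m, f z ≤ 0 → z ∉ frontier {y | f y ≤ 0} →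
      x ∈ frontier {y | f y ≤ 0} → |(f z - f x) / ‖z - x‖| < ε → τ < |rMinDirDeriv f z| := by
  by_contra! hcon
  choose z x hz hzf hx hlt hle using fun k : ℕ => hcon (1 / ((k : ℝ) + 1)) (by positivity)
  have hlim : Tendsto (fun k => (f (z k) - f (x k)) / ‖z k - x k‖) atTop (𝓝 0) :=
    squeeze_zero_norm (fun k => (hlt k).le) tendsto_one_div_add_atTop_nhds_zero_nat
  have := hqc z x (fun k => ⟨hz k, hzf k⟩) hx hlim
  refine this.not_ge ?_
  refine (liminf_le_liminf (Eventually.of_forall fun k =>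
    ENNReal.ofReal_le_ofReal (hle k))).trans ?_
  simp

/-- Uniform descent of `f` at rate `τ` where `f` is at least `-ε` times the distance to the
boundary point `z`. -/
theorem exists_descent_of_QCr {f : Euc m → ℝ} (hf : ConvexOn ℝ univ f) {τ : ℝ} (hτ : 0 < τ)
    (hfr : ∀ x ∈ frontier {y | f y ≤ 0}, τ < |rMinDirDeriv f x|) {ε₀ : ℝ}
    (hqc : ∀ z x : Euc m, f z ≤ 0 → z ∉ frontier {y | f y ≤ 0} →
      x ∈ frontier {y | f y ≤ 0} → |(f z - f x) / ‖z - x‖| < ε₀ → τ < |rMinDirDeriv f z|)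
    {z : Euc m} (hz : z ∈ frontier {y | f y ≤ 0}) (hzneg : rMinDirDeriv f z < 0)
    {ε : ℝ} (hε : 0 ≤ ε) (hετ : ε < τ) (hεε₀ : ε < ε₀) {y : Euc m} (hy : -(ε * ‖y - z‖) ≤ f y) :
    ∃ h : Euc m, ‖h‖ = 1 ∧ ∃ t > (0 : ℝ), f (y + t • h) ≤ f y - τ * t := by
  have hfc : Continuous f := hf.locallyLipschitz.continuous
  have hfz : f z = 0 := frontier_le_subset_eq hfc continuous_const hz
  have key : ∀ y : Euc m, f y ≤ 0 → -(ε * ‖y - z‖) ≤ f y → τ < |rMinDirDeriv f y| →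
      ∃ h : Euc m, ‖h‖ = 1 ∧ ∃ t > (0 : ℝ), f (y + t • h) ≤ f y - τ * t := by
    intro y hy0 hy habs
    rcases lt_abs.1 habs with hpos | hneg
    · have hg := sharp_growth_of_lt_rMinDirDeriv hτ.le hpos z
      rw [hfz, norm_sub_rev] at hg
      have hyz : y = z := by
        rw [← sub_eq_zero, ← norm_eq_zero]
        nlinarith [norm_nonneg (y - z)]
      subst hyz
      linarith
    · obtain ⟨h, hh, t, ht, hlt⟩ := exists_descent_of_rMinDirDeriv_lt hτ.le
        (show rMinDirDeriv f y < -τ by linarith)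
      exact ⟨h, hh, t, ht, hlt.le⟩
  have hdescfr : ∀ x ∈ frontier {y | f y ≤ 0},
      ∃ h : Euc m, ‖h‖ = 1 ∧ ∃ t > (0 : ℝ), f (x + t • h) ≤ f x - τ * t := by
    intro x hx
    have hfx : f x = 0 := frontier_le_subset_eq hfc continuous_const hx
    exact key x hfx.le (by rw [hfx]; nlinarith [norm_nonneg (x - z)]) (hfr x hx)
  rcases le_or_gt (f y) 0 with hy0 | hy0
  · by_cases hyfr : y ∈ frontier {y | f y ≤ 0}
    · exact hdescfr y hyfr
    · refine key y hy0 hy (hqc y z hy0 hyfr hz ?_)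
      have hyz : y ≠ z := by rintro rfl; exact hyfr hz
      have hn : 0 < ‖y - z‖ := norm_pos_iff.2 (sub_ne_zero.2 hyz)
      rw [hfz, sub_zero, abs_div, abs_norm, div_lt_iff₀ hn, abs_of_nonpos hy0]
      nlinarith
  · obtain ⟨x, hfx, hn, hle⟩ := exists_frontier_le_of_descent hf ⟨z, hfz.le⟩ hτ hdescfr hy0
    refine ⟨‖y - x‖⁻¹ • (x - y), ?_, ‖y - x‖, hn, ?_⟩
    · rw [norm_smul, norm_inv, norm_norm, norm_sub_rev x y, inv_mul_cancel₀ hn.ne']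
    · rw [smul_inv_smul₀ hn.ne', add_sub_cancel, hfx]
      linarith

end

/-- Theorem 4.2, (i) ⇒ (ii). -/
theorem stmt18 {m : ℕ} {I : Type*} [TopologicalSpace I] [CompactSpace I] [T2Space I]
    [Nonempty I] (F : I → Euc m → ℝ) (hconv : ∀ i, ConvexOn ℝ Set.univ (F i))
    (hcont : Continuous fun p : I × Euc m => F p.1 p.2) (τ : ℝ) (hτ : 0 < τ)
    (hinf : ENNReal.ofReal τ <
      ⨅ x ∈ frontier {y : Euc m | fmax F y ≤ 0}, ENNReal.ofReal |rMinDirDeriv (fmax F) x|)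
    (hqc : QCr (fmax F) τ) :
    ∃ c > (0:ℝ), ∃ ε > (0:ℝ), ∀ G : I → Euc m → ℝ,
      (Continuous fun p : I × Euc m => G p.1 p.2) →
      (∀ i, ConvexOn ℝ Set.univ (G i)) →
      (∃ z ∈ frontier {y : Euc m | fmax F y ≤ 0}, ∀ i, F i z = G i z) →
      (⨆ i, lipR (fun x => F i x - G i x)) < ENNReal.ofReal ε →
      (∀ x : Euc m, rMinDirDeriv (fmax F) x < 0 → activeSet G x ⊆ activeSet F x) →
      (∀ x : Euc m, 0 < rMinDirDeriv (fmax F) x → activeSet F x ⊆ activeSet G x) →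
      tauMinSys G ≤ ENNReal.ofReal c := by
  set f := fmax F with hfdef
  have hf : ConvexOn ℝ univ f := convexOn_fmax hcont hconv
  have hfc : Continuous f := hf.locallyLipschitz.continuous
  have hfr : ∀ x ∈ frontier {y | f y ≤ 0}, τ < |rMinDirDeriv f x| := fun x hx =>
    (ENNReal.ofReal_lt_ofReal_iff_of_nonneg hτ.le).1 (hinf.trans_le (iInf₂_le x hx))
  obtain ⟨ε₀, hε₀, hqc'⟩ := hqc.exists_uniform
  have hε : 0 < min (ε₀ / 2) (τ / 4) := by positivity
  refine ⟨2 / τ, by positivity, min (ε₀ / 2) (τ / 4), hε, ?_⟩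
  rintro G hGcont hGconv ⟨z, hz, hFGz⟩ hlip hact -
  set ε := min (ε₀ / 2) (τ / 4)
  have hε1 : ε < ε₀ := (min_le_left _ _).trans_lt (by linarith)
  have hε2 : ε ≤ τ / 4 := min_le_right _ _
  have hL : ∀ i u v, |(F i u - G i u) - (F i v - G i v)| ≤ ε * ‖u - v‖ := fun i =>
    abs_sub_le_of_lipR_lt hε.le
      ((le_iSup (fun i => lipR fun x => F i x - G i x) i).trans hlip.le)
  have hfz : f z = 0 := frontier_le_subset_eq hfc continuous_const hz
  have hgz : fmax G z = 0 := by
    rw [← hfz]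
    exact iSup_congr fun i => (hFGz i).symm
  have hfg : ∀ x, f x ≤ fmax G x + ε * ‖x - z‖ := fun x => ciSup_le fun i => by
    linarith [(abs_le.1 (hL i x z)).2, hFGz i, le_fmax hGcont x i]
  have hgf : ∀ x, fmax G x ≤ f x + ε * ‖x - z‖ := fun x => ciSup_le fun i => by
    linarith [(abs_le.1 (hL i x z)).1, hFGz i, le_fmax hcont x i]
  refine tauMinSys_le hGcont (by positivity) fun x hx => ?_
  rcases lt_abs.1 (hfr z hz) with hpos | hneg
  · refine ⟨z, hgz.le, ?_⟩
    have hg := sharp_growth_of_lt_rMinDirDeriv hτ.le hpos x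
    have := hfg x
    rw [div_mul_eq_mul_div, le_div_iff₀ hτ]
    nlinarith [norm_nonneg (x - z)]
  have hg : ConvexOn ℝ univ (fmax G) := convexOn_fmax hGcont hGconv
  have hgc : Continuous (fmax G) := hg.locallyLipschitz.continuous
  suffices H : ∀ y ∈ frontier {y | fmax G y ≤ 0},
      ∃ h : Euc m, ‖h‖ = 1 ∧ ∃ t > (0 : ℝ), fmax G (y + t • h) ≤ fmax G y - τ / 2 * t by
    obtain ⟨y, hy, -, hle⟩ := exists_frontier_le_of_descent hg ⟨z, hgz.le⟩ (half_pos hτ) H hx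
    refine ⟨y, hy.le, ?_⟩
    rw [div_mul_eq_mul_div, le_div_iff₀ hτ]
    linarith
  intro y hy
  have hgy : fmax G y = 0 := frontier_le_subset_eq hgc continuous_const hy
  obtain ⟨h, hh, t, ht, hlt⟩ := exists_descent_of_QCr hf hτ hfr hqc' hz (by linarith)
    hε.le (by linarith) hε1 (y := y) (by linarith [hgf y])
  have hsub := hact y (rMinDirDeriv_neg_of_descent hf hh ht (by nlinarith))
  have hGy : ∀ i, G i y ≤ 0 := fun i => (le_fmax hGcont y i).trans hgy.le
  obtain ⟨s, hs, H⟩ := exists_uniform_descent (h := h) (δ := τ / 2) hGcont hGconv hGy fun i => by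
    rcases (hGy i).lt_or_eq with hlt0 | heq0
    · have hcs : Continuous fun s : ℝ => G i (y + s • h) + τ / 2 * s :=
        ((hGconv i).locallyLipschitz.continuous.comp (by fun_prop)).add (by fun_prop)
      have hev : ∀ᶠ s in 𝓝[>] (0 : ℝ), G i (y + s • h) + τ / 2 * s < 0 :=
        (hcs.tendsto 0).mono_left nhdsWithin_le_nhds |>.eventually_lt_const (by simpa using hlt0)
      obtain ⟨s, hs, hs0⟩ := (hev.and self_mem_nhdsWithin).exists
      exact ⟨s, hs0, by linarith⟩
    · have hiF : F i y = f y := hsub (show G i y = fmax G y by rw [heq0, hgy])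
      refine ⟨t, ht, ?_⟩
      have h1 := (abs_le.1 (hL i (y + t • h) y)).1
      rw [add_sub_cancel_left, norm_smul, hh, Real.norm_of_nonneg ht.le, mul_one] at h1
      have h2 := le_fmax hcont (y + t • h) i
      nlinarith
  refine ⟨h, hh, s, hs, ciSup_le fun i => ?_⟩
  rw [hgy, zero_sub]
  exact H i
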